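/- arXiv:1411.2344 — 2 statements merged into one kernel-verified Lean document; each statement's English description precedes it below -/
import Mathlib

section
/- Vertex set shrinking in Zémor's iteration: Let G be an (N,d,λ)-expander with double cover H, and let S ⊆ E(H) with |S| ≤ δNd. Define S₀ = S, and inductively S_{i} as the set of edges of S_{i−1} whose left (for odd i) or right (for even i) endpoint has more than δ₀d edges of S_{i−1} incident to it, with V_i the set of such high-degree endpoints. If δ = δ₀²/4, d > 16/δ, and λ < 3√d, then whenever S_i is nonempty, |V_{i+1}| < |V_i|/3. -/
open Matrix in
lemma zs_mixing {N d : ℕ} (G : SimpleGraph (Fin N)) [DecidableRel G.Adj]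
    (hreg : G.IsRegularOfDegree d)
    (hA : (G.adjMatrix ℝ).IsHermitian) (i₀ : Fin N) (htop : hA.eigenvalues i₀ = d)
    (l : ℝ) (hl : ∀ i : Fin N, i ≠ i₀ → |hA.eigenvalues i| ≤ l) (hl0 : 0 ≤ l) (hld : l < d)
    (x y : Fin N → ℝ) :
    x ⬝ᵥ (G.adjMatrix ℝ *ᵥ y) ≤ d * (x ⬝ᵥ 1) * (y ⬝ᵥ 1) / N
      + l * (Real.sqrt (x ⬝ᵥ x) * Real.sqrt (y ⬝ᵥ y)) := by
  set M := G.adjMatrix ℝ with hM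
  let e : Fin N → Fin N → ℝ := fun i => (hA.eigenvectorBasis i).ofLp
  have hpars : ∀ x y : Fin N → ℝ, ∑ i, (x ⬝ᵥ e i) * (y ⬝ᵥ e i) = x ⬝ᵥ y := by
    intro x y
    have h := hA.eigenvectorBasis.sum_inner_mul_inner (WithLp.toLp 2 x) (WithLp.toLp 2 y)
    simp only [EuclideanSpace.inner_eq_star_dotProduct, star_trivial] at h
    rw [dotProduct_comm x y, ← h]
    refine Finset.sum_congr rfl fun i _ => ?_
    rw [dotProduct_comm x (e i)]
  have hsymm : ∀ u v : Fin N → ℝ, u ⬝ᵥ (M *ᵥ v) = (M *ᵥ u) ⬝ᵥ v := by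
    intro u v
    rw [dotProduct_mulVec, ← mulVec_transpose, hM, SimpleGraph.transpose_adjMatrix]
  have heig : ∀ i, M *ᵥ e i = hA.eigenvalues i • e i := fun i => hA.mulVec_eigenvectorBasis i
  have hone : M *ᵥ (1 : Fin N → ℝ) = (d : ℝ) • (1 : Fin N → ℝ) := by
    ext v
    simp [hM, SimpleGraph.adjMatrix_mulVec_apply, hreg v]
  have hz : ∀ i, i ≠ i₀ → (1 : Fin N → ℝ) ⬝ᵥ e i = 0 := by
    intro i hi
    have h := hsymm 1 (e i)
    rw [heig, hone, dotProduct_smul, smul_dotProduct, smul_eq_mul, smul_eq_mul] at h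
    have h2 : hA.eigenvalues i < d := lt_of_le_of_lt (le_trans (le_abs_self _) (hl i hi)) hld
    have h3 : (hA.eigenvalues i - d) * ((1 : Fin N → ℝ) ⬝ᵥ e i) = 0 := by linarith
    rcases mul_eq_zero.1 h3 with h4 | h4
    · linarith
    · exact h4
  have hsingle : ∀ x : Fin N → ℝ, (x ⬝ᵥ e i₀) * ((1 : Fin N → ℝ) ⬝ᵥ e i₀) = x ⬝ᵥ 1 := by
    intro x
    rw [← hpars x 1]
    symm
    apply Finset.sum_eq_single i₀
    · intro i _ hi
      rw [hz i hi, mul_zero]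
    · simp
  have hN : (0 : ℝ) < N := by
    have := i₀.pos
    exact_mod_cast this
  have h11 : ((1 : Fin N → ℝ) ⬝ᵥ e i₀) * ((1 : Fin N → ℝ) ⬝ᵥ e i₀) = N := by
    rw [hsingle]; simp
  have hmain : (x ⬝ᵥ e i₀) * (y ⬝ᵥ e i₀) = (x ⬝ᵥ 1) * (y ⬝ᵥ 1) / N := by
    rw [eq_div_iff hN.ne', ← hsingle x, ← hsingle y, ← h11]; ring
  have hexp : x ⬝ᵥ (M *ᵥ y) = ∑ i, hA.eigenvalues i * ((x ⬝ᵥ e i) * (y ⬝ᵥ e i)) := by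
    rw [← hpars]
    refine Finset.sum_congr rfl fun i _ => ?_
    rw [← hsymm, heig, dotProduct_smul, smul_eq_mul]; ring
  rw [hexp, ← Finset.add_sum_erase _ _ (Finset.mem_univ i₀), htop, hmain]
  have hsub : ∀ x : Fin N → ℝ, ∑ i ∈ Finset.univ.erase i₀, |x ⬝ᵥ e i| ^ 2 ≤ x ⬝ᵥ x := by
    intro x
    rw [← hpars x x]
    simp only [sq_abs, ← sq]
    exact Finset.sum_le_sum_of_subset_of_nonneg (Finset.erase_subset _ _)
      fun i _ _ => sq_nonneg _
  have hrest : ∑ i ∈ Finset.univ.erase i₀, hA.eigenvalues i * ((x ⬝ᵥ e i) * (y ⬝ᵥ e i))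
      ≤ l * ∑ i ∈ Finset.univ.erase i₀, |x ⬝ᵥ e i| * |y ⬝ᵥ e i| := by
    rw [Finset.mul_sum]
    refine Finset.sum_le_sum fun i hi => ?_
    refine (le_abs_self _).trans ?_
    rw [abs_mul, abs_mul]
    exact mul_le_mul_of_nonneg_right (hl i (Finset.ne_of_mem_erase hi)) (by positivity)
  have hcs := Real.sum_mul_le_sqrt_mul_sqrt (Finset.univ.erase i₀)
    (fun i => |x ⬝ᵥ e i|) (fun i => |y ⬝ᵥ e i|)
  have h3 := mul_le_mul (Real.sqrt_le_sqrt (hsub x)) (Real.sqrt_le_sqrt (hsub y))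
    (Real.sqrt_nonneg _) (Real.sqrt_nonneg _)
  have h4 := mul_le_mul_of_nonneg_left (hcs.trans h3) hl0
  have h5 : (d : ℝ) * (x ⬝ᵥ 1) * (y ⬝ᵥ 1) / N = d * ((x ⬝ᵥ 1) * (y ⬝ᵥ 1) / N) := by ring
  rw [h5]
  linarith

open Matrix in
lemma zs_core {N d : ℕ} (G : SimpleGraph (Fin N)) [DecidableRel G.Adj]
    (hreg : G.IsRegularOfDegree d)
    (hA : (G.adjMatrix ℝ).IsHermitian) (i₀ : Fin N) (htop : hA.eigenvalues i₀ = d)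
    (lam δ δ₀ : ℝ)
    (hlam : ∀ i : Fin N, i ≠ i₀ → |hA.eigenvalues i| ≤ lam)
    (hδ : δ = δ₀ ^ 2 / 4) (hδ₀ : 0 < δ₀) (hd : 16 / δ < d)
    (hlam3 : lam < 3 * Real.sqrt d)
    (T T' : Finset G.Dart) (f g : G.Dart → Fin N)
    (hadj : ∀ e, G.Adj (f e) (g e))
    (hinj : ∀ e e', f e = f e' → g e = g e' → e = e')
    (hT : (T.card : ℝ) ≤ δ * N * d) (A B : Finset (Fin N))
    (hAm : ∀ v ∈ A, δ₀ * d < ((T.filter fun e => f e = v).card : ℝ))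
    (hBm : ∀ v ∈ B, δ₀ * d < ((T'.filter fun e => g e = v).card : ℝ))
    (hTA : ∀ e ∈ T', f e ∈ A) (hne : T'.Nonempty) :
    (B.card : ℝ) < A.card / 3 := by
  have hδpos : 0 < δ := by rw [hδ]; positivity
  have hdpos : (0 : ℝ) < d := lt_trans (by positivity) hd
  obtain ⟨e0, he0⟩ := hne
  have haA := hTA e0 he0
  have hapos : (0 : ℝ) < A.card := by exact_mod_cast Finset.card_pos.2 ⟨_, haA⟩
  have hN : (0 : ℝ) < N := by
    have := i₀.pos
    exact_mod_cast this
  -- δ₀ < 1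
  have hle : (T.filter fun e => f e = f e0).card ≤ d := by
    rw [← hreg (f e0), ← SimpleGraph.card_neighborFinset_eq_degree]
    apply Finset.card_le_card_of_injOn g
    · intro e he
      have he := (Finset.mem_filter.1 he).2
      simpa [← he] using hadj e
    · intro e he e' he' h
      have he := (Finset.mem_filter.1 he).2
      have he' := (Finset.mem_filter.1 he').2
      exact hinj _ _ (he.trans he'.symm) h
  have hlt : δ₀ < 1 := by
    have h1 := hAm _ haA
    have h2 : ((T.filter fun e => f e = f e0).card : ℝ) ≤ d := by exact_mod_cast hle
    nlinarith
  have hd64 : 64 < δ₀ ^ 2 * d := by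
    rw [div_lt_iff₀ hδpos, hδ] at hd
    linarith
  have hdbig : (64 : ℝ) < d := by nlinarith
  have hs0 : 0 < Real.sqrt d := Real.sqrt_pos.2 hdpos
  have hss : Real.sqrt d * Real.sqrt d = d := Real.mul_self_sqrt hdpos.le
  have hsd : 3 * Real.sqrt d < d := by nlinarith
  -- |A| bound
  have hAcard : (A.card : ℝ) * δ₀ ≤ δ * N := by
    have h1 : ∑ v ∈ A, (T.filter fun e => f e = v).card ≤ T.card := by
      rw [← Finset.card_biUnion]
      · exact Finset.card_le_card (Finset.biUnion_subset.2 fun v _ => Finset.filter_subset _ _)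
      · intro u _ v _ huv
        rw [Function.onFun, Finset.disjoint_left]
        intro e he he2
        exact huv ((Finset.mem_filter.1 he).2.symm.trans (Finset.mem_filter.1 he2).2)
    have h2 : (A.card : ℝ) * (δ₀ * d) ≤ ∑ v ∈ A, ((T.filter fun e => f e = v).card : ℝ) := by
      rw [← nsmul_eq_mul]
      exact Finset.card_nsmul_le_sum _ _ _ fun v hv => (hAm v hv).le
    have h3 : ∑ v ∈ A, ((T.filter fun e => f e = v).card : ℝ) ≤ T.card := by exact_mod_cast h1
    have h4 : (A.card : ℝ) * δ₀ * d ≤ δ * N * d := by linarith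
    exact le_of_mul_le_mul_right h4 hdpos
  let x : Fin N → ℝ := fun v => if v ∈ B then 1 else 0
  let y : Fin N → ℝ := fun v => if v ∈ A then 1 else 0
  have hmix := zs_mixing G hreg hA i₀ htop (3 * Real.sqrt d)
    (fun i hi => (hlam i hi).trans hlam3.le) (by positivity) hsd x y
  have hx1 : x ⬝ᵥ 1 = B.card := by simp [x, dotProduct]
  have hy1 : y ⬝ᵥ 1 = A.card := by simp [y, dotProduct]
  have hxx : x ⬝ᵥ x = B.card := by simp [x, dotProduct]
  have hyy : y ⬝ᵥ y = A.card := by simp [y, dotProduct]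
  rw [hx1, hy1, hxx, hyy] at hmix
  have hlow : (B.card : ℝ) * (δ₀ * d) ≤ x ⬝ᵥ (G.adjMatrix ℝ *ᵥ y) := by
    have h1 : x ⬝ᵥ (G.adjMatrix ℝ *ᵥ y) = ∑ v ∈ B, (G.adjMatrix ℝ *ᵥ y) v := by
      simp [x, dotProduct]
    rw [h1, ← nsmul_eq_mul]
    refine Finset.card_nsmul_le_sum _ _ _ fun v hv => (hBm v hv).le.trans ?_
    have h2 : (G.adjMatrix ℝ *ᵥ y) v = (((G.neighborFinset v).filter (· ∈ A)).card : ℝ) := by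
      rw [SimpleGraph.adjMatrix_mulVec_apply]
      simp [y, Finset.filter_mem_eq_inter]
    rw [h2]
    norm_cast
    apply Finset.card_le_card_of_injOn f
    · intro e he
      have he := Finset.mem_filter.1 he
      have h3 := hTA e he.1
      have h4 := (hadj e).symm
      rw [he.2] at h4
      simp [h3, h4]
    · intro e he e' he' h
      have he := (Finset.mem_filter.1 he).2
      have he' := (Finset.mem_filter.1 he').2
      exact hinj _ _ h (he.trans he'.symm)
  have hfin := hlow.trans hmix
  set a := (A.card : ℝ)
  set b := (B.card : ℝ)
  have hb0 : 0 ≤ b := by positivity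
  set s := Real.sqrt d
  rcases hb0.eq_or_lt with hb0 | hbpos
  · rw [← hb0]; positivity
  have hp : 0 < Real.sqrt b := Real.sqrt_pos.2 hbpos
  have hq : 0 < Real.sqrt a := Real.sqrt_pos.2 hapos
  have hpp : Real.sqrt b * Real.sqrt b = b := Real.mul_self_sqrt hbpos.le
  have hqq : Real.sqrt a * Real.sqrt a = a := Real.mul_self_sqrt hapos.le
  set p := Real.sqrt b
  set q := Real.sqrt a
  have haN : a / N ≤ δ₀ / 4 := by
    rw [div_le_iff₀ hN]
    rw [hδ] at hAcard
    have : a * δ₀ ≤ (δ₀ / 4 * N) * δ₀ := by linarith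
    exact le_of_mul_le_mul_right this hδ₀
  have h1 : (d : ℝ) * b * a / N ≤ d * b * (δ₀ / 4) := by
    rw [mul_div_assoc]
    exact mul_le_mul_of_nonneg_left haN (by positivity)
  have h2 : (s * p) * (δ₀ * s * p) ≤ (s * p) * (4 * q) := by
    have : (s * p) * (δ₀ * s * p) = b * (δ₀ * d) := by rw [← hpp, ← hss]; ring
    rw [this]; linarith
  have h3 : δ₀ * s * p ≤ 4 * q := le_of_mul_le_mul_left h2 (by positivity)
  have h4 : (δ₀ * s * p) * (δ₀ * s * p) ≤ (4 * q) * (4 * q) :=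
    mul_le_mul h3 h3 (by positivity) (by positivity)
  have h5 : (δ₀ * s * p) * (δ₀ * s * p) = (δ₀ ^ 2 * d) * b := by rw [← hpp, ← hss]; ring
  have h6 : (4 * q) * (4 * q) = 16 * a := by rw [← hqq]; ring
  rw [h5, h6] at h4
  have h7 : 64 * b < (δ₀ ^ 2 * d) * b := mul_lt_mul_of_pos_right hd64 hbpos
  linarith

/-- Vertex set shrinking in Zémor's iteration: for an `(N,d,λ)`-expander `G` with double
cover `H` (whose edges are the darts of `G`), a set `S` of edges of `H` with
`|S| ≤ δNd`, and the inductively defined sets `S_i`, `V_i` (high-degree endpoints,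
alternating left/right side), if `δ = δ₀²/4`, `d > 16/δ` and `λ < 3√d`, then whenever
`S_i` is nonempty one has `|V_{i+1}| < |V_i|/3`. -/
theorem zemor_shrinking {N d : ℕ} (G : SimpleGraph (Fin N)) [DecidableRel G.Adj]
    (hreg : G.IsRegularOfDegree d)
    (hA : (G.adjMatrix ℝ).IsHermitian) (i₀ : Fin N) (htop : hA.eigenvalues i₀ = d)
    (lam δ δ₀ : ℝ)
    (hlam : ∀ i : Fin N, i ≠ i₀ → |hA.eigenvalues i| ≤ lam)
    (hδ : δ = δ₀ ^ 2 / 4) (hδ₀ : 0 < δ₀) (hd : 16 / δ < d)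
    (hlam3 : lam < 3 * Real.sqrt d)
    (S : ℕ → Finset G.Dart) (V : ℕ → Finset (Fin N))
    (hS0 : ((S 0).card : ℝ) ≤ δ * N * d)
    (hV : ∀ i : ℕ, V (i + 1) = Finset.univ.filter fun v =>
      if (i + 1) % 2 = 1 then
        δ₀ * d < (((S i).filter fun e => e.toProd.1 = v).card : ℝ)
      else
        δ₀ * d < (((S i).filter fun e => e.toProd.2 = v).card : ℝ))
    (hSrec : ∀ i : ℕ, S (i + 1) = (S i).filter fun e =>
      if (i + 1) % 2 = 1 then e.toProd.1 ∈ V (i + 1) else e.toProd.2 ∈ V (i + 1))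
    (i : ℕ) (hi : 1 ≤ i) (hne : (S i).Nonempty) :
    ((V (i + 1)).card : ℝ) < (V i).card / 3 := by
  have hcard : ∀ j, ((S j).card : ℝ) ≤ δ * N * d := by
    intro j
    induction j with
    | zero => exact hS0
    | succ k ih =>
      refine le_trans ?_ ih
      rw [hSrec k]
      exact_mod_cast Finset.card_filter_le _ _
  obtain ⟨k, rfl⟩ : ∃ k, i = k + 1 := ⟨i - 1, by omega⟩
  rcases Nat.mod_two_eq_zero_or_one (k + 1) with hk | hk
  · have hk' : (k + 1 + 1) % 2 = 1 := by omega
    refine zs_core G hreg hA i₀ htop lam δ δ₀ hlam hδ hδ₀ hd hlam3 (S k) (S (k + 1))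
      (fun e => e.toProd.2) (fun e => e.toProd.1) (fun e => e.adj.symm)
      (fun e e' h h' => SimpleGraph.Dart.ext _ _ (Prod.ext h' h)) (hcard k) _ _ ?_ ?_ ?_ hne
    · intro v hv
      rw [hV k] at hv
      simpa [hk] using hv
    · intro v hv
      rw [hV (k + 1)] at hv
      simpa [hk'] using hv
    · intro e he
      rw [hSrec k] at he
      have := (Finset.mem_filter.1 he).2
      simpa [hk] using this
  · have hk' : ¬ (k + 1 + 1) % 2 = 1 := by omega
    refine zs_core G hreg hA i₀ htop lam δ δ₀ hlam hδ hδ₀ hd hlam3 (S k) (S (k + 1))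
      (fun e => e.toProd.1) (fun e => e.toProd.2) (fun e => e.adj)
      (fun e e' h h' => SimpleGraph.Dart.ext _ _ (Prod.ext h h')) (hcard k) _ _ ?_ ?_ ?_ hne
    · intro v hv
      rw [hV k] at hv
      have := (Finset.mem_filter.1 hv).2
      rwa [if_pos hk] at this
    · intro v hv
      rw [hV (k + 1)] at hv
      have := (Finset.mem_filter.1 hv).2
      rwa [if_neg hk'] at this
    · intro e he
      rw [hSrec k] at he
      have := (Finset.mem_filter.1 he).2
      rwa [if_pos hk] at this
end

section
/- Main structural theorem: Let δ > 0, d > 16/δ, δ₀ = 2√δ. Let C₀ ∈ ℝ^{k×d} satisfy the robust null space property of order δ₀d with constants ρ₀ < 1/3 and τ₀ > 0. Let G be an (N,d,λ)-expander with λ < 3√d, and let A ∈ ℝ^{2kN×dN} be the Tanner measurement matrix of G and C₀. Then A satisfies the robust null space property of order δNd with constants ρ = 2ρ₀/(1−ρ₀) < 1 and τ = τ₀/(1−ρ₀). -/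
open Matrix in
lemma mixing_aux {N : ℕ} (A : Matrix (Fin N) (Fin N) ℝ) (hsymm : Aᵀ = A)
    (U : Fin N → Fin N → ℝ) (μ : Fin N → ℝ) (d K : ℝ) (i₀ : Fin N)
    (hP : ∀ f g : Fin N → ℝ, ∑ i, (f ⬝ᵥ U i) * (U i ⬝ᵥ g) = f ⬝ᵥ g)
    (hU : ∀ i, A *ᵥ U i = μ i • U i)
    (h1 : A *ᵥ (fun _ => 1) = fun _ => d)
    (h0 : μ i₀ = d) (hK : ∀ i, i ≠ i₀ → |μ i| ≤ K) (hKd : K < d) (hK0 : 0 ≤ K)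
    (f g : Fin N → ℝ) :
    f ⬝ᵥ (A *ᵥ g) ≤ d * ((∑ i, f i) * (∑ i, g i) / N)
      + K * (Real.sqrt (f ⬝ᵥ f) * Real.sqrt (g ⬝ᵥ g)) := by
  have hN : (0:ℝ) < N := by
    have := i₀.pos
    exact_mod_cast this
  have key : ∀ i (h : Fin N → ℝ), U i ⬝ᵥ (A *ᵥ h) = μ i * (U i ⬝ᵥ h) := by
    intro i h
    rw [dotProduct_mulVec, ← mulVec_transpose, hsymm, hU, smul_dotProduct, smul_eq_mul]
  set one : Fin N → ℝ := fun _ => 1 with hone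
  have hc : ∀ i, i ≠ i₀ → U i ⬝ᵥ one = 0 := by
    intro i hi
    have h2 := key i one
    have h3 : (fun _ => d : Fin N → ℝ) = d • one := by ext; simp [hone]
    rw [h1, h3, dotProduct_smul, smul_eq_mul] at h2
    have h4 : (d - μ i) * (U i ⬝ᵥ one) = 0 := by linarith
    have h5 : d - μ i ≠ 0 := by
      have := le_abs_self (μ i)
      have := hK i hi
      intro h; linarith
    exact (mul_eq_zero.mp h4).resolve_left h5
  have hs : ∀ h : Fin N → ℝ, ∑ i, h i = (h ⬝ᵥ U i₀) * (U i₀ ⬝ᵥ one) := by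
    intro h
    have h2 := hP h one
    rw [Finset.sum_eq_single i₀] at h2
    · rw [h2]; simp [dotProduct, hone]
    · intro b _ hb; rw [hc b hb, mul_zero]
    · simp
  have hNc : (N:ℝ) = (U i₀ ⬝ᵥ one) * (U i₀ ⬝ᵥ one) := by
    have h2 := hs one
    rw [dotProduct_comm one] at h2
    rw [← h2]; simp [hone]
  have hmain : (∑ i, f i) * (∑ i, g i) / N = (f ⬝ᵥ U i₀) * (U i₀ ⬝ᵥ g) := by
    rw [div_eq_iff hN.ne', hs f, hs g, hNc, dotProduct_comm g]; ring
  rw [hmain, ← hP f (A *ᵥ g), ← Finset.add_sum_erase _ _ (Finset.mem_univ i₀)]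
  apply add_le_add
  · rw [key, h0]; apply le_of_eq; ring
  · calc ∑ i ∈ Finset.univ.erase i₀, (f ⬝ᵥ U i) * (U i ⬝ᵥ (A *ᵥ g))
        ≤ ∑ i ∈ Finset.univ.erase i₀, K * (|f ⬝ᵥ U i| * |U i ⬝ᵥ g|) := by
          apply Finset.sum_le_sum
          intro i hi
          rw [key]
          have := hK i (Finset.ne_of_mem_erase hi)
          calc (f ⬝ᵥ U i) * (μ i * (U i ⬝ᵥ g)) ≤ |(f ⬝ᵥ U i) * (μ i * (U i ⬝ᵥ g))| := le_abs_self _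
            _ = |μ i| * (|f ⬝ᵥ U i| * |U i ⬝ᵥ g|) := by rw [abs_mul, abs_mul]; ring
            _ ≤ _ := by gcongr
      _ ≤ ∑ i, K * (|f ⬝ᵥ U i| * |U i ⬝ᵥ g|) := by
          apply Finset.sum_le_sum_of_subset_of_nonneg (Finset.erase_subset _ _)
          intros; positivity
      _ = K * ∑ i, (|f ⬝ᵥ U i| * |U i ⬝ᵥ g|) := by rw [Finset.mul_sum]
      _ ≤ _ := by
          gcongr
          refine (Real.sum_mul_le_sqrt_mul_sqrt _ _ _).trans (le_of_eq ?_)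
          congr 2
          · rw [← hP f f]
            apply Finset.sum_congr rfl; intro i _
            rw [sq_abs, dotProduct_comm (U i), sq]
          · rw [← hP g g]
            apply Finset.sum_congr rfl; intro i _
            rw [sq_abs, dotProduct_comm g, sq]

open Matrix in
lemma mixing_graph {N d : ℕ} (K : ℝ) (G : SimpleGraph (Fin N)) [DecidableRel G.Adj]
    (hreg : G.IsRegularOfDegree d)
    (hA : (G.adjMatrix ℝ).IsHermitian) (i₀ : Fin N) (htop : hA.eigenvalues i₀ = d)
    (hlam : ∀ i : Fin N, i ≠ i₀ → |hA.eigenvalues i| ≤ K) (hKd : K < d) (hK0 : 0 ≤ K)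
    (S : Finset G.Dart) (P Q : Finset (Fin N))
    (hP : ∀ e ∈ S, e.toProd.1 ∈ P) (hQ : ∀ e ∈ S, e.toProd.2 ∈ Q) :
    (S.card : ℝ) ≤ d * ((P.card : ℝ) * Q.card / N)
      + K * (Real.sqrt P.card * Real.sqrt Q.card) := by
  have h := mixing_aux (G.adjMatrix ℝ) (G.transpose_adjMatrix (α := ℝ))
    (fun i => (hA.eigenvectorBasis i).ofLp) hA.eigenvalues d K i₀ ?_ ?_ ?_ htop hlam hKd hK0
    (fun i => if i ∈ P then 1 else 0) (fun i => if i ∈ Q then 1 else 0)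
  · have hS : (S.card : ℝ) ≤ (((P ×ˢ Q).filter fun p => G.Adj p.1 p.2).card : ℝ) := by
      norm_cast
      apply Finset.card_le_card_of_injOn (fun e => e.toProd)
      · intro e he
        have he' : e ∈ S := he
        simp [hP e he', hQ e he', e.adj]
      · intro a _ b _ hab
        exact SimpleGraph.Dart.ext _ _ hab
    refine hS.trans ?_
    refine le_trans (le_of_eq ?_) (h.trans (le_of_eq ?_))
    · rw [Finset.card_filter, Finset.sum_product]
      push_cast
      simp [dotProduct, mulVec, SimpleGraph.adjMatrix_apply, Finset.sum_ite_mem]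
    · simp [dotProduct]
  · intro f g
    have := hA.eigenvectorBasis.sum_inner_mul_inner (WithLp.toLp 2 f) (WithLp.toLp 2 g)
    simp only [EuclideanSpace.inner_eq_star_dotProduct, star_trivial] at this
    rw [dotProduct_comm f g, ← this]
    apply Finset.sum_congr rfl; intro i _
    rw [dotProduct_comm f, dotProduct_comm g]
  · intro i
    exact hA.mulVec_eigenvectorBasis i
  · ext v
    simp [mulVec, dotProduct, SimpleGraph.adjMatrix_apply]
    have := hreg v
    rw [← SimpleGraph.card_neighborFinset_eq_degree] at this
    rw [← this]
    congr 2
    ext; simp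

lemma peel_aux {N d : ℕ} (δ : ℝ) (hδ : 0 < δ) (hδ1 : δ < 1) (hd : 16 / δ < d)
    (G : SimpleGraph (Fin N)) [DecidableRel G.Adj] (hN : 0 < N)
    (hmix : ∀ (S : Finset G.Dart) (P Q : Finset (Fin N)),
      (∀ e ∈ S, e.toProd.1 ∈ P) → (∀ e ∈ S, e.toProd.2 ∈ Q) →
      (S.card : ℝ) ≤ d * ((P.card : ℝ) * Q.card / N)
      + 3 * Real.sqrt d * (Real.sqrt P.card * Real.sqrt Q.card))
    (S : Finset G.Dart) (hne : S.Nonempty) (hS : (S.card : ℝ) ≤ δ * N * d) :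
    ∃ v, ((0 < (S.filter fun e => e.toProd.1 = v).card ∧
        ((S.filter fun e => e.toProd.1 = v).card : ℝ) ≤ 2 * Real.sqrt δ * d) ∨
      (0 < (S.filter fun e => e.toProd.2 = v).card ∧
        ((S.filter fun e => e.toProd.2 = v).card : ℝ) ≤ 2 * Real.sqrt δ * d)) := by
  by_contra! hcon
  set P := S.image (fun e => e.toProd.1) with hPdef
  set Q := S.image (fun e => e.toProd.2) with hQdef
  have hP : (P.card : ℝ) * (2 * Real.sqrt δ * d) ≤ S.card := by
    rw [Finset.card_eq_sum_card_image (fun e : G.Dart => e.toProd.1) S, ← nsmul_eq_mul]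
    push_cast
    apply Finset.card_nsmul_le_sum
    intro v hv
    refine ((hcon v).1 ?_).le
    obtain ⟨e, he, hev⟩ := Finset.mem_image.1 hv
    exact Finset.card_pos.2 ⟨e, Finset.mem_filter.2 ⟨he, hev⟩⟩
  have hQ : (Q.card : ℝ) * (2 * Real.sqrt δ * d) ≤ S.card := by
    rw [Finset.card_eq_sum_card_image (fun e : G.Dart => e.toProd.2) S, ← nsmul_eq_mul]
    push_cast
    apply Finset.card_nsmul_le_sum
    intro v hv
    refine ((hcon v).2 ?_).le
    obtain ⟨e, he, hev⟩ := Finset.mem_image.1 hv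
    exact Finset.card_pos.2 ⟨e, Finset.mem_filter.2 ⟨he, hev⟩⟩
  have hm := hmix S P Q (fun e he => Finset.mem_image_of_mem _ he)
    (fun e he => Finset.mem_image_of_mem _ he)
  have hP0 : (0:ℝ) < P.card := by
    exact_mod_cast Finset.card_pos.2 (hne.image _)
  have hQ0 : (0:ℝ) < Q.card := by
    exact_mod_cast Finset.card_pos.2 (hne.image _)
  have hN' : (0:ℝ) < N := by exact_mod_cast hN
  have hdp : (0:ℝ) < d := lt_trans (by positivity) hd
  set a := Real.sqrt P.card with ha
  set b := Real.sqrt Q.card with hb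
  have ha2 : (P.card : ℝ) = a ^ 2 := (Real.sq_sqrt hP0.le).symm
  have hb2 : (Q.card : ℝ) = b ^ 2 := (Real.sq_sqrt hQ0.le).symm
  have ha0 : 0 < a := Real.sqrt_pos.2 hP0
  have hb0 : 0 < b := Real.sqrt_pos.2 hQ0
  set s := Real.sqrt δ with hs
  set t := Real.sqrt d with ht
  have hs2 : δ = s ^ 2 := (Real.sq_sqrt hδ.le).symm
  have ht2 : (d:ℝ) = t ^ 2 := (Real.sq_sqrt hdp.le).symm
  have hs0 : 0 < s := Real.sqrt_pos.2 hδ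
  have ht0 : 0 < t := Real.sqrt_pos.2 hdp
  have hst : 4 < s * t := by
    rw [div_lt_iff₀ hδ, hs2, ht2] at hd
    nlinarith [mul_pos hs0 ht0]
  clear_value a b s t
  rw [ha2, hb2, ht2] at hm
  rw [ha2, ht2] at hP
  rw [hb2, ht2] at hQ
  rw [hs2, ht2] at hS
  -- a ^ 2 ≤ s N / 2 and likewise for b
  have hPN : a ^ 2 ≤ s * N / 2 := by
    have h := hP.trans hS
    have hp : 0 < 2 * s * t ^ 2 := by positivity
    refine le_of_mul_le_mul_right (h.trans (le_of_eq ?_)) hp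
    ring
  have hQN : b ^ 2 ≤ s * N / 2 := by
    have h := hQ.trans hS
    have hp : 0 < 2 * s * t ^ 2 := by positivity
    refine le_of_mul_le_mul_right (h.trans (le_of_eq ?_)) hp
    ring
  have hab : a * b ≤ s * N / 2 := by nlinarith [sq_nonneg (a - b)]
  have h1 : a ^ 2 * b ^ 2 / N ≤ a * b * (s / 2) := by
    rw [div_le_iff₀ hN']
    nlinarith [mul_pos ha0 hb0]
  have h2 : a * b * (2 * s * t ^ 2) ≤ S.card := by
    have : 0 < 2 * s * t ^ 2 := by positivity
    nlinarith [mul_nonneg this.le (sq_nonneg (a - b))]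
  have h3 : t ^ 2 * (a ^ 2 * b ^ 2 / N) ≤ t ^ 2 * (a * b * (s / 2)) := by gcongr
  have h4 : (a * b * t) * (2 * (s * t)) ≤ (a * b * t) * (s * t / 2 + 3) := by
    nlinarith
  have h5 := le_of_mul_le_mul_left h4 (by positivity)
  linarith

lemma partition_aux {D V : Type*} [DecidableEq D] [DecidableEq V] (p q : D → V) (M : ℝ) (c : ℝ)
    (hM : 0 ≤ M)
    (hpeel : ∀ S : Finset D, S.Nonempty → (S.card : ℝ) ≤ c →
      ∃ v, ((0 < (S.filter fun e => p e = v).card ∧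
        ((S.filter fun e => p e = v).card : ℝ) ≤ M) ∨
      (0 < (S.filter fun e => q e = v).card ∧
        ((S.filter fun e => q e = v).card : ℝ) ≤ M))) :
    ∀ S : Finset D, (S.card : ℝ) ≤ c →
      ∃ T R : Finset D, T ∪ R = S ∧ Disjoint T R ∧
        (∀ v, ((T.filter fun e => p e = v).card : ℝ) ≤ M) ∧
        (∀ v, ((R.filter fun e => q e = v).card : ℝ) ≤ M) := by
  intro S
  induction S using Finset.strongInduction with
  | H S ih =>
    intro hS
    rcases S.eq_empty_or_nonempty with rfl | hne
    · exact ⟨∅, ∅, by simp, by simp, fun _ => by simpa using hM, fun _ => by simpa using hM⟩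
    · obtain ⟨v, hv | hv⟩ := hpeel S hne hS
      · have hsub : S.filter (fun e => ¬ p e = v) ⊂ S := by
          rw [Finset.filter_ssubset]
          obtain ⟨e, he⟩ := Finset.card_pos.1 hv.1
          rw [Finset.mem_filter] at he
          exact ⟨e, he.1, not_not.2 he.2⟩
        obtain ⟨T, R, hTR, hdis, hT, hR⟩ := ih _ hsub
          (le_trans (by exact_mod_cast Finset.card_le_card hsub.1) hS)
        have hmem : ∀ e, (e ∈ T ∨ e ∈ R) ↔ (e ∈ S ∧ ¬ p e = v) := by
          intro e; rw [← Finset.mem_union, hTR, Finset.mem_filter]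
        refine ⟨T ∪ S.filter (fun e => p e = v), R, ?_, ?_, ?_, hR⟩
        · ext e
          have := hmem e
          simp only [Finset.mem_union, Finset.mem_filter]
          tauto
        · rw [Finset.disjoint_left] at hdis ⊢
          intro e he
          have := hmem e
          have := @hdis e
          simp only [Finset.mem_union, Finset.mem_filter] at he
          tauto
        · intro w
          by_cases hw : w = v
          · subst hw
            refine le_trans ?_ hv.2
            norm_cast
            apply Finset.card_le_card
            intro e
            have := hmem e
            simp only [Finset.mem_union, Finset.mem_filter]
            tauto
          · refine le_trans ?_ (hT w)
            norm_cast
            apply Finset.card_le_card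
            intro e
            simp only [Finset.mem_union, Finset.mem_filter]
            rintro ⟨h | h, h'⟩
            · exact ⟨h, h'⟩
            · exact absurd (h'.symm.trans h.2) hw
      · have hsub : S.filter (fun e => ¬ q e = v) ⊂ S := by
          rw [Finset.filter_ssubset]
          obtain ⟨e, he⟩ := Finset.card_pos.1 hv.1
          rw [Finset.mem_filter] at he
          exact ⟨e, he.1, not_not.2 he.2⟩
        obtain ⟨T, R, hTR, hdis, hT, hR⟩ := ih _ hsub
          (le_trans (by exact_mod_cast Finset.card_le_card hsub.1) hS)
        have hmem : ∀ e, (e ∈ T ∨ e ∈ R) ↔ (e ∈ S ∧ ¬ q e = v) := by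
          intro e; rw [← Finset.mem_union, hTR, Finset.mem_filter]
        refine ⟨T, R ∪ S.filter (fun e => q e = v), ?_, ?_, hT, ?_⟩
        · ext e
          have := hmem e
          simp only [Finset.mem_union, Finset.mem_filter]
          tauto
        · rw [Finset.disjoint_left] at hdis ⊢
          intro e he
          have := hmem e
          have := @hdis e
          simp only [Finset.mem_union, Finset.mem_filter]
          tauto
        · intro w
          by_cases hw : w = v
          · subst hw
            refine le_trans ?_ hv.2
            norm_cast
            apply Finset.card_le_card
            intro e
            have := hmem e
            simp only [Finset.mem_union, Finset.mem_filter]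
            tauto
          · refine le_trans ?_ (hR w)
            norm_cast
            apply Finset.card_le_card
            intro e
            simp only [Finset.mem_union, Finset.mem_filter]
            rintro ⟨h | h, h'⟩
            · exact ⟨h, h'⟩
            · exact absurd (h'.symm.trans h.2) hw

lemma half_aux {N d k : ℕ} {D : Type*} [Fintype D] [DecidableEq D] (M ρ₀ τ₀ : ℝ)
    (C₀ : Matrix (Fin k) (Fin d) ℝ)
    (hC₀ : ∀ T : Finset (Fin d), (T.card : ℝ) ≤ M → ∀ v : Fin d → ℝ,
      ∑ j ∈ T, |v j| ≤ ρ₀ * ∑ j ∈ Tᶜ, |v j| + τ₀ * ∑ i, |C₀.mulVec v i|)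
    (e : Fin N → Fin d → D) (he : Function.Bijective fun p : Fin N × Fin d => e p.1 p.2)
    (π : D → Fin N) (hπ : ∀ v j, π (e v j) = v)
    (T : Finset D) (hT : ∀ v, ((T.filter fun a => π a = v).card : ℝ) ≤ M) (x : D → ℝ) :
    ∑ a ∈ T, |x a| ≤ ρ₀ * ∑ a ∈ Tᶜ, |x a|
      + τ₀ * ∑ v, ∑ i, |C₀.mulVec (fun j => x (e v j)) i| := by
  have hsum : ∀ R : Finset D, ∑ a ∈ R, |x a| =
      ∑ v, ∑ j ∈ Finset.univ.filter (fun j => e v j ∈ R), |x (e v j)| := by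
    intro R
    have h1 : ∑ a ∈ R, |x a| = ∑ a, if a ∈ R then |x a| else 0 := by simp
    rw [h1, ← he.sum_comp (fun a => if a ∈ R then |x a| else 0), Fintype.sum_prod_type]
    simp [Finset.sum_filter]
  rw [hsum T, hsum Tᶜ, Finset.mul_sum, Finset.mul_sum, ← Finset.sum_add_distrib]
  apply Finset.sum_le_sum
  intro v _
  have h := hC₀ (Finset.univ.filter (fun j => e v j ∈ T)) ?_ (fun j => x (e v j))
  · have hc : Finset.univ.filter (fun j => e v j ∈ Tᶜ)
        = (Finset.univ.filter (fun j => e v j ∈ T))ᶜ := by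
      ext j; simp
    rw [hc]
    exact h
  · refine le_trans ?_ (hT v)
    norm_cast
    apply Finset.card_le_card_of_injOn (fun j => e v j)
    · intro j hj
      simp at hj
      simp [hj, hπ]
    · intro a _ b _ hab
      have := @he.1 (v, a) (v, b) hab
      simpa using this

/-- Main structural theorem: let `δ > 0`, `d > 16/δ`, `δ₀ = 2√δ`; let `C₀` satisfy the
robust null space property of order `δ₀ d` with constants `ρ₀ < 1/3` and `τ₀ > 0`; let
`G` be an `(N,d,λ)`-expander with `λ < 3√d` and let `A` be the Tanner measurement
matrix of `G` and `C₀` (defined on the edges of the double cover of `G`, i.e. the darts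
of `G`). Then `A` satisfies the robust null space property of order `δNd` with
constants `ρ = 2ρ₀/(1-ρ₀)` and `τ = τ₀/(1-ρ₀)`. -/
theorem tanner_rnsp_main {N d k : ℕ} (δ δ₀ ρ₀ τ₀ lam : ℝ)
    (hδ : 0 < δ) (hd : 16 / δ < d) (hδ₀ : δ₀ = 2 * Real.sqrt δ)
    (C₀ : Matrix (Fin k) (Fin d) ℝ)
    (hρ0 : 0 < ρ₀) (hρ3 : ρ₀ < 1 / 3) (hτ : 0 < τ₀)
    (hC₀ : ∀ T : Finset (Fin d), (T.card : ℝ) ≤ δ₀ * d → ∀ v : Fin d → ℝ,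
      ∑ j ∈ T, |v j| ≤ ρ₀ * ∑ j ∈ Tᶜ, |v j| + τ₀ * ∑ i, |C₀.mulVec v i|)
    (G : SimpleGraph (Fin N)) [DecidableRel G.Adj]
    (hreg : G.IsRegularOfDegree d)
    (hA : (G.adjMatrix ℝ).IsHermitian) (i₀ : Fin N) (htop : hA.eigenvalues i₀ = d)
    (hlam : ∀ i : Fin N, i ≠ i₀ → |hA.eigenvalues i| ≤ lam)
    (hlam3 : lam < 3 * Real.sqrt d)
    (eL eR : Fin N → Fin d → G.Dart)
    (heL1 : ∀ v j, (eL v j).toProd.1 = v)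
    (heL2 : Function.Bijective fun p : Fin N × Fin d => eL p.1 p.2)
    (heR1 : ∀ v j, (eR v j).toProd.2 = v)
    (heR2 : Function.Bijective fun p : Fin N × Fin d => eR p.1 p.2)
    (A : Matrix ((Fin N ⊕ Fin N) × Fin k) G.Dart ℝ)
    (hAdef : A = Matrix.of fun p e =>
      match p.1 with
      | Sum.inl v => ∑ j, if eL v j = e then C₀ p.2 j else 0
      | Sum.inr v => ∑ j, if eR v j = e then C₀ p.2 j else 0) :
    ∀ S : Finset G.Dart, (S.card : ℝ) ≤ δ * N * d → ∀ x : G.Dart → ℝ,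
      ∑ e ∈ S, |x e| ≤ (2 * ρ₀ / (1 - ρ₀)) * ∑ e ∈ Sᶜ, |x e| +
        (τ₀ / (1 - ρ₀)) * ∑ p, |A.mulVec x p| := by
  intro S hS x
  have hdp : (0:ℝ) < d := lt_trans (by positivity) hd
  have hs0 : 0 < Real.sqrt δ := Real.sqrt_pos.2 hδ
  have hM : 0 ≤ 2 * Real.sqrt δ * d := by positivity
  subst hδ₀
  have hpart : ∃ T R : Finset G.Dart, T ∪ R = S ∧ Disjoint T R ∧
        (∀ v, ((T.filter fun e => e.toProd.1 = v).card : ℝ) ≤ 2 * Real.sqrt δ * d) ∧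
        (∀ v, ((R.filter fun e => e.toProd.2 = v).card : ℝ) ≤ 2 * Real.sqrt δ * d) := by
    by_cases hδ1 : δ < 1
    · have hd16 : (16:ℝ) < d := by
        rw [div_lt_iff₀ hδ] at hd
        nlinarith
      have ht4 : 4 < Real.sqrt d := by
        rw [Real.lt_sqrt (by norm_num)]; linarith
      have hK : 3 * Real.sqrt d < d := by
        nlinarith [Real.sq_sqrt hdp.le]
      refine partition_aux (fun e : G.Dart => e.toProd.1) (fun e => e.toProd.2) _ (δ * N * d) hM
        ?_ S hS
      intro S' hne hS'
      exact peel_aux δ hδ hδ1 hd G i₀.pos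
        (fun S P Q hP hQ => mixing_graph (3 * Real.sqrt d) G hreg hA i₀ htop
          (fun i hi => (hlam i hi).trans hlam3.le) hK (by positivity) S P Q hP hQ) S' hne hS'
    · refine ⟨S, ∅, by simp, by simp, ?_, fun _ => by simpa using hM⟩
      intro v
      have h1 : (S.filter fun e => e.toProd.1 = v).card ≤ d := by
        have h2 : (S.filter fun e => e.toProd.1 = v) ⊆ Finset.univ.image (eL v) := by
          intro e he
          obtain ⟨⟨w, j⟩, rfl⟩ := heL2.2 e
          rw [Finset.mem_filter] at he
          have := he.2
          simp only [heL1] at this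
          subst this
          simp
        refine (Finset.card_le_card h2).trans (Finset.card_image_le.trans ?_)
        simp
      have h3 : 1 ≤ Real.sqrt δ := Real.one_le_sqrt.2 (not_lt.1 hδ1)
      have h4 : ((S.filter fun e => e.toProd.1 = v).card : ℝ) ≤ d := by exact_mod_cast h1
      nlinarith
  obtain ⟨T, R, hTR, hdis, hT, hR⟩ := hpart
  have hL := half_aux _ ρ₀ τ₀ C₀ hC₀ eL heL2 (fun e : G.Dart => e.toProd.1) heL1 T hT x
  have hRr := half_aux _ ρ₀ τ₀ C₀ hC₀ eR heR2 (fun e : G.Dart => e.toProd.2) heR1 R hR x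
  have hAx : ∑ p, |A.mulVec x p| = ∑ v, ∑ i, |C₀.mulVec (fun j => x (eL v j)) i|
      + ∑ v, ∑ i, |C₀.mulVec (fun j => x (eR v j)) i| := by
    rw [Fintype.sum_prod_type, Fintype.sum_sum_type]
    congr 1
    · refine Finset.sum_congr rfl fun v _ => Finset.sum_congr rfl fun i _ => ?_
      congr 1
      simp only [hAdef, Matrix.mulVec, dotProduct, Matrix.of_apply, Finset.sum_mul]
      rw [Finset.sum_comm]
      simp
    · refine Finset.sum_congr rfl fun v _ => Finset.sum_congr rfl fun i _ => ?_
      congr 1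
      simp only [hAdef, Matrix.mulVec, dotProduct, Matrix.of_apply, Finset.sum_mul]
      rw [Finset.sum_comm]
      simp
  have hSu : ∑ e ∈ S, |x e| = ∑ e ∈ T, |x e| + ∑ e ∈ R, |x e| := by
    rw [← hTR, Finset.sum_union hdis]
  have e1 := Finset.sum_add_sum_compl T (fun e => |x e|)
  have e2 := Finset.sum_add_sum_compl R (fun e => |x e|)
  have e3 := Finset.sum_add_sum_compl S (fun e => |x e|)
  have hpos : 0 < 1 - ρ₀ := by linarith
  rw [hAx, div_mul_eq_mul_div, div_mul_eq_mul_div, ← add_div, le_div_iff₀ hpos]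
  have e4 : ∑ e ∈ Tᶜ, |x e| = ∑ e, |x e| - ∑ e ∈ T, |x e| := by linarith
  have e5 : ∑ e ∈ Rᶜ, |x e| = ∑ e, |x e| - ∑ e ∈ R, |x e| := by linarith
  have e6 : ∑ e ∈ Sᶜ, |x e| = ∑ e, |x e| - (∑ e ∈ T, |x e| + ∑ e ∈ R, |x e|) := by linarith
  rw [e4] at hL
  rw [e5] at hRr
  rw [e6, hSu]
  linarith
end
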